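/- arXiv:1106.2703 — 2 statements merged into one kernel-verified Lean document; each statement's English description precedes it below -/
import Mathlib

section
/- Let 0 < q < 1 and suppose Gosper's duplication formulas hold for the parameter q, i.e. sin_q(2z) = S(q)·sin_{q²}(z)·cos_{q²}(z) and cos_q(2z) = cos_{q²}(z)² − sin_{q²}(z)² for all real z. Then sin_{q²}(π/4) = cos_{q²}(π/4) = 1/√(S(q)). -/
open Real

/-- The infinite q-Pochhammer symbol `(x; q)_∞ = ∏_{n=0}^∞ (1 - x qⁿ)`. -/
noncomputable def qPoch (x q : ℝ) : ℝ := ∏' n : ℕ, (1 - x * q ^ n)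

/-- Gosper's q-sine, as a function of its actual argument `w`
(so `qSin q (π * z)` is `sin_q(π z)` from the paper). -/
noncomputable def qSin (q w : ℝ) : ℝ :=
  q ^ ((w / π - 1 / 2) ^ 2) * qPoch (q ^ (2 * (w / π))) (q ^ 2) *
    qPoch (q ^ (2 - 2 * (w / π))) (q ^ 2) / (qPoch q (q ^ 2)) ^ 2

/-- Gosper's q-cosine, as a function of its actual argument `w`. -/
noncomputable def qCos (q w : ℝ) : ℝ :=
  q ^ ((w / π) ^ 2) * qPoch (q ^ (1 - 2 * (w / π))) (q ^ 2) *
    qPoch (q ^ (1 + 2 * (w / π))) (q ^ 2) / (qPoch q (q ^ 2)) ^ 2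

/-- Gosper's constant `S(q) = q^{-1/4} (q²;q⁴)_∞⁴ / (q;q²)_∞²`. -/
noncomputable def gosperS (q : ℝ) : ℝ :=
  q ^ (-(1 / 4 : ℝ)) * (qPoch (q ^ 2) (q ^ 4)) ^ 4 / (qPoch q (q ^ 2)) ^ 2

/-- The q-Gamma function `Γ_q(z) = ((q;q)_∞ / (q^z;q)_∞) (1-q)^{1-z}`. -/
noncomputable def qGamma (q z : ℝ) : ℝ :=
  qPoch q q / qPoch (q ^ z) q * (1 - q) ^ (1 - z)

theorem qPoch_pos {x q : ℝ} (hx0 : 0 ≤ x) (hx1 : x < 1) (hq0 : 0 ≤ q) (hq1 : q < 1) :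
    0 < qPoch x q := by
  have hs : Summable fun n : ℕ => -(x * q ^ n) :=
    ((summable_geometric_of_lt_one hq0 hq1).mul_left x).neg
  have hpos : ∀ n : ℕ, 0 < 1 - x * q ^ n := fun n => by
    have := mul_le_of_le_one_right hx0 (pow_le_one₀ hq0 hq1.le (n := n))
    linarith
  have hlog : Summable fun n : ℕ => Real.log (1 - x * q ^ n) := by
    simpa [sub_eq_add_neg] using Real.summable_log_one_add_of_summable hs
  rw [qPoch, ← Real.rexp_tsum_eq_tprod hpos hlog]
  exact Real.exp_pos _

/-- The `q`-sine equals one at `π / 2`. -/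
theorem qSin_pi_div_two {q : ℝ} (hq0 : 0 < q) (hq1 : q < 1) : qSin q (π / 2) = 1 := by
  have hP : qPoch q (q ^ 2) ≠ 0 :=
    (qPoch_pos hq0.le hq1 (by positivity) (pow_lt_one₀ hq0.le hq1 two_ne_zero)).ne'
  have h : π / 2 / π = 1 / 2 := by field_simp
  have h2 : (2 : ℝ) - 2 * (1 / 2) = 1 := by norm_num
  have h1 : (2 : ℝ) * (1 / 2) = 1 := by norm_num
  rw [qSin, h, h2, h1, Real.rpow_one, sub_self, zero_pow two_ne_zero, Real.rpow_zero, one_mul]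
  field_simp

theorem qSin_pi_div_four_eq_qCos (q : ℝ) : qSin q (π / 4) = qCos q (π / 4) := by
  have h : π / 4 / π = 1 / 4 := by field_simp
  rw [qSin, qCos, h]
  norm_num

theorem qCos_pi_div_four_pos {q : ℝ} (hq0 : 0 < q) (hq1 : q < 1) : 0 < qCos q (π / 4) := by
  have h : π / 4 / π = 1 / 4 := by field_simp
  have hsq0 : 0 ≤ q ^ 2 := by positivity
  have hsq1 : q ^ 2 < 1 := pow_lt_one₀ hq0.le hq1 two_ne_zero
  have hpow : ∀ a : ℝ, 0 < a → 0 < qPoch (q ^ a) (q ^ 2) := fun a ha =>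
    qPoch_pos (Real.rpow_nonneg hq0.le a) (Real.rpow_lt_one hq0.le hq1 ha) hsq0 hsq1
  have h1 := hpow (1 - 2 * (1 / 4)) (by norm_num)
  have h2 := hpow (1 + 2 * (1 / 4)) (by norm_num)
  have h3 := qPoch_pos hq0.le hq1 hsq0 hsq1
  rw [qCos, h]
  positivity

/-- assuming Gosper's duplication formulas, the values at pi/4. -/
theorem qSin_qCos_quarter (q : ℝ) (hq0 : 0 < q) (hq1 : q < 1)
    (hsin : ∀ z : ℝ, qSin q (2 * z) = gosperS q * qSin (q ^ 2) z * qCos (q ^ 2) z)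
    (hcos : ∀ z : ℝ, qCos q (2 * z) = qCos (q ^ 2) z ^ 2 - qSin (q ^ 2) z ^ 2) :
    qSin (q ^ 2) (π / 4) = 1 / Real.sqrt (gosperS q) ∧
      qCos (q ^ 2) (π / 4) = 1 / Real.sqrt (gosperS q) := by
  have hc : 0 < qCos (q ^ 2) (π / 4) :=
    qCos_pi_div_four_pos (by positivity) (pow_lt_one₀ hq0.le hq1 two_ne_zero)
  have hS := hsin (π / 4)
  rw [show 2 * (π / 4) = π / 2 by ring, qSin_pi_div_two hq0 hq1, qSin_pi_div_four_eq_qCos] at hS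
  rw [qSin_pi_div_four_eq_qCos, and_self]
  have hval : gosperS q = (1 / qCos (q ^ 2) (π / 4)) ^ 2 := by
    field_simp
    linarith
  rw [hval, Real.sqrt_sq (by positivity), one_div_one_div]
end

section
/- Let 0 < q < 1 and suppose Gosper's duplication formulas hold for the parameter q, i.e. sin_q(2z) = S(q)·sin_{q²}(z)·cos_{q²}(z) and cos_q(2z) = cos_{q²}(z)² − sin_{q²}(z)² for all real z. Then Γ_{q²}(1/4) · Γ_{q²}(3/4) = (1−q²) · (q²;q²)_∞⁴ (q;q²)_∞² / ((q;q)_∞² (√q;q)_∞). -/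
open Real

theorem summable_norm_neg_mul_pow (x : ℝ) {q : ℝ} (hq0 : 0 ≤ q) (hq1 : q < 1) :
    Summable fun n : ℕ => ‖-(x * q ^ n)‖ :=
  ((summable_geometric_of_lt_one hq0 hq1).mul_left x).neg.norm

theorem multipliable_one_sub_mul_pow (x : ℝ) {q : ℝ} (hq0 : 0 ≤ q) (hq1 : q < 1) :
    Multipliable fun n : ℕ => 1 - x * q ^ n := by
  simpa only [sub_eq_add_neg] using
    multipliable_one_add_of_summable (summable_norm_neg_mul_pow x hq0 hq1)

theorem qPoch_ne_zero {x q : ℝ} (hx : |x| < 1) (hq0 : 0 ≤ q) (hq1 : q < 1) :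
    qPoch x q ≠ 0 := by
  have h := tprod_one_add_ne_zero_of_summable (f := fun n : ℕ => -(x * q ^ n))
    (fun n => ?_) (summable_norm_neg_mul_pow x hq0 hq1)
  · simpa only [qPoch, sub_eq_add_neg] using h
  · have hn : |x * q ^ n| < 1 := by
      rw [abs_mul, abs_of_nonneg (pow_nonneg hq0 n)]
      exact (mul_le_of_le_one_right (abs_nonneg x) (pow_le_one₀ hq0 hq1.le)).trans_lt hx
    have := (abs_lt.mp hn).2
    linarith

/-- Splitting the factors of `(x; q)_∞` by the parity of the exponent. -/
theorem qPoch_eq_mul_qPoch_sq (x : ℝ) {q : ℝ} (hq0 : 0 ≤ q) (hq1 : q < 1) :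
    qPoch x q = qPoch x (q ^ 2) * qPoch (x * q) (q ^ 2) := by
  have hs0 : 0 ≤ q ^ 2 := sq_nonneg q
  have hs1 : q ^ 2 < 1 := pow_lt_one₀ hq0 hq1 two_ne_zero
  have he (n : ℕ) : 1 - x * q ^ (2 * n) = 1 - x * (q ^ 2) ^ n := by rw [pow_mul]
  have ho (n : ℕ) : 1 - x * q ^ (2 * n + 1) = 1 - x * q * (q ^ 2) ^ n := by
    rw [pow_succ, pow_mul]; ring
  have h := tprod_even_mul_odd (f := fun n : ℕ => 1 - x * q ^ n)
    (by simpa only [he] using multipliable_one_sub_mul_pow x hs0 hs1)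
    (by simpa only [ho] using multipliable_one_sub_mul_pow (x * q) hs0 hs1)
  simp only [he, ho] at h
  exact h.symm

/-- the q-analogue of the classical product Gamma(1/4) Gamma(3/4) = pi sqrt 2. -/
theorem qGamma_quarter_product (q : ℝ) (hq0 : 0 < q) (hq1 : q < 1)
    (hsin : ∀ z : ℝ, qSin q (2 * z) = gosperS q * qSin (q ^ 2) z * qCos (q ^ 2) z)
    (hcos : ∀ z : ℝ, qCos q (2 * z) = qCos (q ^ 2) z ^ 2 - qSin (q ^ 2) z ^ 2) :
    qGamma (q ^ 2) (1 / 4) * qGamma (q ^ 2) (3 / 4) =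
      (1 - q ^ 2) * ((qPoch (q ^ 2) (q ^ 2)) ^ 4 * (qPoch q (q ^ 2)) ^ 2 /
        ((qPoch q q) ^ 2 * qPoch (Real.sqrt q) q)) := by
  have hs1 : q ^ 2 < 1 := pow_lt_one₀ hq0.le hq1 two_ne_zero
  have hq : qPoch q q = qPoch q (q ^ 2) * qPoch (q ^ 2) (q ^ 2) := by
    rw [qPoch_eq_mul_qPoch_sq q hq0.le hq1, ← pow_two]
  have hA : qPoch q (q ^ 2) ≠ 0 :=
    qPoch_ne_zero (by rwa [abs_of_pos hq0]) (sq_nonneg q) hs1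
  have hB : qPoch (q ^ 2) (q ^ 2) ≠ 0 :=
    qPoch_ne_zero (by rwa [abs_of_nonneg (sq_nonneg q)]) (sq_nonneg q) hs1
  have h1 : (q ^ 2) ^ (1 / 4 : ℝ) = √q := by
    rw [← rpow_natCast_mul hq0.le, sqrt_eq_rpow]
    norm_num
  have h3 : (q ^ 2) ^ (3 / 4 : ℝ) = √q * q := by
    rw [← rpow_natCast_mul hq0.le, sqrt_eq_rpow, ← rpow_add_one hq0.ne']
    norm_num
  have hp : (1 - q ^ 2) ^ (1 - 1 / 4 : ℝ) * (1 - q ^ 2) ^ (1 - 3 / 4 : ℝ) = 1 - q ^ 2 := by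
    rw [← rpow_add (sub_pos.mpr hs1)]
    norm_num
  calc qGamma (q ^ 2) (1 / 4) * qGamma (q ^ 2) (3 / 4)
      = (1 - q ^ 2) ^ (1 - 1 / 4 : ℝ) * (1 - q ^ 2) ^ (1 - 3 / 4 : ℝ) *
          (qPoch (q ^ 2) (q ^ 2) ^ 2 / (qPoch (√q) (q ^ 2) * qPoch (√q * q) (q ^ 2))) := by
        rw [qGamma, qGamma, h1, h3]
        ring
    _ = _ := by
        rw [hp, ← qPoch_eq_mul_qPoch_sq (√q) hq0.le hq1, hq]
        field_simp
end
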